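/- arXiv:2505.17220 — 3 statements merged into one kernel-verified Lean document; each statement's English description precedes it below -/
import Mathlib

section
/- Let t ∈ ℝ^{n+1} be timelike (η(t,t) < 0) and let s, w ∈ ℝ^{n+1} be timelike vectors with η(s,t) < 0 and η(w,t) < 0. Then η(s,w) < 0. -/
/-- The Minkowski bilinear form `η(x,y) = -x₀y₀ + ∑_{i=1}^{n} xᵢyᵢ` on `ℝ^{n+1}`. -/
noncomputable def minkowski {n : ℕ} (x y : Fin (n + 1) → ℝ) : ℝ :=
  (∑ i, x i * y i) - 2 * x 0 * y 0

theorem minkowski_neg_iff_aux (n : ℕ) (x y : Fin (n + 1) → ℝ)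
    (hx : minkowski x x < 0) (hy : minkowski y y < 0) :
    minkowski x y < 0 ↔ 0 < x 0 * y 0 := by
  have cs := Finset.sum_mul_sq_le_sq_mul_sq Finset.univ (fun i : Fin n => x i.succ)
    (fun i : Fin n => y i.succ)
  have hA : 0 ≤ ∑ i : Fin n, x i.succ ^ 2 := Finset.sum_nonneg fun i _ => sq_nonneg _
  have hB : 0 ≤ ∑ i : Fin n, y i.succ ^ 2 := Finset.sum_nonneg fun i _ => sq_nonneg _
  simp only [minkowski, Fin.sum_univ_succ, ← pow_two] at hx hy ⊢
  generalize (∑ i : Fin n, x i.succ ^ 2) = A at *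
  generalize (∑ i : Fin n, y i.succ ^ 2) = B at *
  generalize (∑ i : Fin n, x i.succ * y i.succ) = C at *
  have h1 : A < x 0 ^ 2 := by nlinarith
  have h2 : B < y 0 ^ 2 := by nlinarith
  have h3 : A * B < x 0 ^ 2 * y 0 ^ 2 := mul_lt_mul'' h1 h2 hA hB
  have h4 : |C| < |x 0 * y 0| := by
    apply sq_lt_sq.mp
    rw [mul_pow]
    linarith
  constructor
  · intro h
    by_contra hn
    rw [abs_of_nonpos (not_lt.mp hn)] at h4
    linarith [neg_abs_le C]
  · intro h
    rw [abs_of_pos h] at h4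
    linarith [le_abs_self C]

/-- Two timelike vectors `s`, `w` that are future directed with respect to a timelike
time orientation `t` (i.e. `η(s,t) < 0`, `η(w,t) < 0`) satisfy `η(s,w) < 0`. -/
theorem future_timelike_inner_neg (n : ℕ) (t s w : Fin (n + 1) → ℝ)
    (ht : minkowski t t < 0) (hs : minkowski s s < 0) (hw : minkowski w w < 0)
    (hst : minkowski s t < 0) (hwt : minkowski w t < 0) :
    minkowski s w < 0 := by
  rw [minkowski_neg_iff_aux n _ _ hs ht] at hst
  rw [minkowski_neg_iff_aux n _ _ hw ht] at hwt
  rw [minkowski_neg_iff_aux n _ _ hs hw]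
  have h := mul_pos hst hwt
  by_contra hn
  nlinarith [mul_nonneg (neg_nonneg.mpr (not_lt.mp hn)) (sq_nonneg (t 0))]
end

section
/- Let b > 0, θ₀ < 0, and let θ : ℝ → ℝ be a function which is differentiable at every λ ∈ [0, b] with derivative satisfying θ′(λ) ≤ −θ(λ)²/2 there, and with θ(0) = θ₀. Then b < 2/|θ₀|. (Equivalently: a solution of the focusing inequality dθ/dλ + θ²/2 ≤ 0 with negative initial value θ₀ cannot remain finite beyond affine parameter 2/|θ₀|; along the way 1/θ(λ) ≥ 1/θ₀ + λ/2 while θ stays negative.) -/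
/-- Raychaudhuri focusing: if `θ` is differentiable on `[0,b]` with
`θ′ ≤ −θ²/2` there and `θ(0) = θ₀ < 0`, then `b < 2/|θ₀|`;
i.e. the expansion diverges to `−∞` within affine parameter `2/|θ₀|`. -/
theorem focusing_blowup (b θ₀ : ℝ) (hb : 0 < b) (hθ₀ : θ₀ < 0) (θ : ℝ → ℝ)
    (hdiff : ∀ l ∈ Set.Icc (0 : ℝ) b,
      DifferentiableAt ℝ θ l ∧ deriv θ l ≤ -(θ l) ^ 2 / 2)
    (h0 : θ 0 = θ₀) :
    b < 2 / |θ₀| := by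
  have hanti : AntitoneOn θ (Set.Icc 0 b) := by
    apply antitoneOn_of_deriv_nonpos (convex_Icc 0 b)
    · exact fun l hl => (hdiff l hl).1.continuousAt.continuousWithinAt
    · exact fun l hl => (hdiff l (interior_subset hl)).1.differentiableWithinAt
    · intro l hl
      have := (hdiff l (interior_subset hl)).2
      nlinarith [sq_nonneg (θ l)]
  have hneg : ∀ l ∈ Set.Icc (0 : ℝ) b, θ l < 0 := by
    intro l hl
    have := hanti (Set.left_mem_Icc.2 hb.le) hl hl.1
    linarith
  have hd : ∀ l ∈ Set.Icc (0 : ℝ) b,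
      HasDerivAt (fun x => (θ x)⁻¹ - x / 2) (-deriv θ l / (θ l) ^ 2 - 1 / 2) l := by
    intro l hl
    exact ((hdiff l hl).1.hasDerivAt.fun_inv (hneg l hl).ne).sub ((hasDerivAt_id l).div_const 2)
  have hmono : MonotoneOn (fun x => (θ x)⁻¹ - x / 2) (Set.Icc 0 b) := by
    apply monotoneOn_of_deriv_nonneg (convex_Icc 0 b)
    · exact fun l hl => (hd l hl).continuousAt.continuousWithinAt
    · exact fun l hl => (hd l (interior_subset hl)).differentiableAt.differentiableWithinAt
    · intro l hl
      have hl' := interior_subset hl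
      rw [(hd l hl').deriv]
      have h1 := (hdiff l hl').2
      have h2 : 0 < (θ l) ^ 2 := sq_pos_of_neg (hneg l hl')
      rw [sub_nonneg, le_div_iff₀ h2]
      linarith
  have h := hmono (Set.left_mem_Icc.2 hb.le) (Set.right_mem_Icc.2 hb.le) hb.le
  have hbn := inv_lt_zero.2 (hneg b (Set.right_mem_Icc.2 hb.le))
  simp only [h0] at h
  rw [abs_of_neg hθ₀, div_neg, div_eq_mul_inv]
  linarith
end

section
/- Smarr's formula for the Kerr black hole as an identity: let r_s > 0 and a ≥ 0 satisfy 2a < r_s. Set s = √(r_s² − 4a²), r₊ = (r_s + s)/2, and define the surface gravity κ = s / (r_s(r_s + s)), the horizon area A = 4π(r₊² + a²), the horizon angular velocity Ω = a/(r₊² + a²), the mass M = r_s/2, and the angular momentum L = M·a (geometrized units G = c = 1). Then M = (1/(4π))·κ·A + 2·Ω·L. -/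
/-- Smarr's formula for a slow Kerr black hole (geometrized units `G = c = 1`):
with `s = √(r_s² − 4a²)`, `r₊ = (r_s + s)/2`, surface gravity `κ = s/(r_s(r_s+s))`,
horizon area `A = 4π(r₊² + a²)`, horizon angular velocity `Ω = a/(r₊² + a²)`,
mass `M = r_s/2` and angular momentum `L = M·a`, one has
`M = (1/4π)·κ·A + 2·Ω·L`. -/
theorem smarr_formula (rs a : ℝ) (hrs : 0 < rs) (ha : 0 ≤ a) (hslow : 2 * a < rs)
    (s rp κ A Ω M L : ℝ)
    (hs : s = Real.sqrt (rs ^ 2 - 4 * a ^ 2))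
    (hrp : rp = (rs + s) / 2)
    (hκ : κ = s / (rs * (rs + s)))
    (hA : A = 4 * Real.pi * (rp ^ 2 + a ^ 2))
    (hΩ : Ω = a / (rp ^ 2 + a ^ 2))
    (hM : M = rs / 2)
    (hL : L = M * a) :
    M = (1 / (4 * Real.pi)) * κ * A + 2 * Ω * L := by
  have hs0 : 0 ≤ s := hs ▸ Real.sqrt_nonneg _
  have hsq : s ^ 2 = rs ^ 2 - 4 * a ^ 2 := by
    rw [hs]
    exact Real.sq_sqrt (by nlinarith)
  have hpos : 0 < rs + s := by linarith
  have hq : rp ^ 2 + a ^ 2 = rs * (rs + s) / 2 := by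
    rw [hrp]
    linarith
  have hne : rs + s ≠ 0 := hpos.ne'
  have hrne : rs ≠ 0 := hrs.ne'
  have hpi : Real.pi ≠ 0 := Real.pi_ne_zero
  have h1 : (1 / (4 * Real.pi)) * κ * A = s / 2 := by
    rw [hA, hq, hκ]
    field_simp
  have h2 : 2 * Ω * L = (rs - s) / 2 := by
    rw [hL, hM, hΩ, hq]
    field_simp
    linarith
  rw [h1, h2, hM]
  ring
end
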